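/- If G is a unicyclic graph with n ≥ 4 vertices, then n/2 ≤ ID(G) ≤ 1/(n-1) + n - 2, where ID(G) = Σ_{u ∈ V(G)} 1/d_u. Equality in the lower bound holds if and only if G = C_n, and in the upper bound if and only if G = U_n^3. -/

import Mathlib

open Finset SimpleGraph

/-- A unicyclic graph: connected with as many edges as vertices. -/
def IsUnicyclic {n : ℕ} (G : SimpleGraph (Fin n)) [DecidableRel G.Adj] : Prop :=
  G.Connected ∧ G.edgeFinset.card = n

/-- The graph `U_n^3`: a triangle on vertices 0,1,2 with n-3 pendant edges attached to 0. -/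
def unicyclicStar (n : ℕ) : SimpleGraph (Fin n) :=
  SimpleGraph.fromRel (fun i j => i.val = 0 ∨ (i.val = 1 ∧ j.val = 2))

lemma not_acyclic_of_unicyclic {n : ℕ} (G : SimpleGraph (Fin n)) [DecidableRel G.Adj]
    (hG : IsUnicyclic G) : ∃ m, 3 ≤ m ∧ ∃ f : cycleGraph m →g G, Function.Injective f := by
  have h : ¬ G.IsAcyclic := by
    intro ha
    have hT : G.IsTree := ⟨hG.1, ha⟩
    have h1 := hT.card_edgeFinset
    have h2 := hG.2
    simp only [Fintype.card_fin] at h1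
    omega
  rw [isAcyclic_iff_free_cycleGraph] at h
  push Not at h
  obtain ⟨m, hm, hc⟩ := h
  obtain ⟨f⟩ := hc
  exact ⟨m, hm, f.toHom, f.injective⟩

lemma cycleGraph_degree' {m : ℕ} (hm : 3 ≤ m) (i : Fin m) : (cycleGraph m).degree i = 2 := by
  obtain ⟨k, rfl⟩ : ∃ k, m = k + 3 := ⟨m - 3, by omega⟩
  exact cycleGraph_degree_three_le

lemma image_subset {n m : ℕ} (G : SimpleGraph (Fin n)) [DecidableRel G.Adj]
    (f : cycleGraph m →g G) (i : Fin m) :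
    ((cycleGraph m).neighborFinset i).image f ⊆ G.neighborFinset (f i) := by
  intro x hx
  simp only [Finset.mem_image, mem_neighborFinset] at hx ⊢
  obtain ⟨j, hj, rfl⟩ := hx
  exact f.map_adj hj

lemma card_image_two {n m : ℕ} (hm : 3 ≤ m) (G : SimpleGraph (Fin n)) [DecidableRel G.Adj]
    (f : cycleGraph m →g G) (hf : Function.Injective f) (i : Fin m) :
    (((cycleGraph m).neighborFinset i).image f).card = 2 := by
  rw [Finset.card_image_of_injective _ hf, card_neighborFinset_eq_degree, cycleGraph_degree' hm]

lemma three_le_nonleaf {n : ℕ} (G : SimpleGraph (Fin n)) [DecidableRel G.Adj]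
    (hG : IsUnicyclic G) : 3 ≤ (Finset.univ.filter (fun u => 2 ≤ G.degree u)).card := by
  obtain ⟨m, hm, f, hf⟩ := not_acyclic_of_unicyclic G hG
  have h1 : (Finset.univ.image f).card = m := by
    rw [Finset.card_image_of_injective _ hf]; simp
  refine hm.trans (h1 ▸ Finset.card_le_card ?_)
  intro x hx
  simp only [Finset.mem_image, Finset.mem_univ, true_and, Finset.mem_filter] at hx ⊢
  obtain ⟨i, rfl⟩ := hx
  rw [← card_image_two hm G f hf i, ← card_neighborFinset_eq_degree]
  exact Finset.card_le_card (image_subset G f i)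

lemma iso_cycle {n : ℕ} (G : SimpleGraph (Fin n)) [DecidableRel G.Adj]
    (hG : IsUnicyclic G) (h2 : ∀ u, G.degree u = 2) : Nonempty (G ≃g cycleGraph n) := by
  obtain ⟨m, hm, f, hf⟩ := not_acyclic_of_unicyclic G hG
  have heq : ∀ i, ((cycleGraph m).neighborFinset i).image f = G.neighborFinset (f i) := by
    intro i
    apply Finset.eq_of_subset_of_card_le (image_subset G f i)
    rw [card_image_two hm G f hf i, card_neighborFinset_eq_degree, h2]
  have hadj : ∀ i y, G.Adj (f i) y → ∃ j, (cycleGraph m).Adj i j ∧ f j = y := by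
    intro i y h
    have : y ∈ G.neighborFinset (f i) := by simpa using h
    rw [← heq] at this
    simpa using this
  have hw : ∀ x y, G.Walk x y → x ∈ Set.range f → y ∈ Set.range f := by
    intro x y p
    induction p with
    | nil => exact id
    | cons h p ih =>
      rintro ⟨i, rfl⟩
      obtain ⟨j, _, hj⟩ := hadj i _ h
      exact ih ⟨j, hj⟩
  have hsurj : Function.Surjective f := by
    intro y
    obtain ⟨p⟩ := hG.1.preconnected (f ⟨0, by omega⟩) y
    exact hw _ _ p ⟨_, rfl⟩
  have hmn : m = n := by
    have := Fintype.card_of_bijective ⟨hf, hsurj⟩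
    simpa using this
  subst hmn
  have hb : Function.Bijective f := ⟨hf, hsurj⟩
  refine ⟨(RelIso.mk (Equiv.ofBijective f hb) ?_ : cycleGraph m ≃g G).symm⟩
  intro a b
  change G.Adj (f a) (f b) ↔ _
  constructor
  · intro h
    obtain ⟨j, hj, hjb⟩ := hadj a _ h
    rwa [← hf hjb]
  · exact fun h => f.map_adj h

lemma exists_perm {n : ℕ} (v a b x y z : Fin n) (h1 : v ≠ a) (h2 : v ≠ b) (h3 : a ≠ b)
    (k1 : x ≠ y) (k2 : x ≠ z) (k3 : y ≠ z) :
    ∃ e : Fin n ≃ Fin n, e v = x ∧ e a = y ∧ e b = z := by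
  obtain ⟨e1, e1v⟩ : ∃ e : Fin n ≃ Fin n, e v = x := ⟨Equiv.swap v x, by simp⟩
  obtain ⟨e2, e2v, e2a⟩ : ∃ e : Fin n ≃ Fin n, e v = x ∧ e a = y := by
    refine ⟨e1.trans (Equiv.swap (e1 a) y), ?_, by simp⟩
    have : x ≠ e1 a := by rw [← e1v]; exact fun h => h1 (e1.injective h)
    simp [e1v, Equiv.swap_apply_of_ne_of_ne this k1]
  refine ⟨e2.trans (Equiv.swap (e2 b) z), ?_, ?_, by simp⟩
  · have : x ≠ e2 b := by rw [← e2v]; exact fun h => h2 (e2.injective h)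
    simp [e2v, Equiv.swap_apply_of_ne_of_ne this k2]
  · have : y ≠ e2 b := by rw [← e2a]; exact fun h => h3 (e2.injective h)
    simp [e2a, Equiv.swap_apply_of_ne_of_ne this k3]

lemma two_le_degree {n : ℕ} (G : SimpleGraph (Fin n)) [DecidableRel G.Adj] {x y z : Fin n}
    (h1 : G.Adj x y) (h2 : G.Adj x z) (h : y ≠ z) : 2 ≤ G.degree x := by
  rw [← card_neighborFinset_eq_degree, ← Finset.card_pair h]
  apply Finset.card_le_card
  intro w hw
  simp only [Finset.mem_insert, Finset.mem_singleton, mem_neighborFinset] at hw ⊢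
  rcases hw with rfl | rfl <;> assumption

lemma iso_star {n : ℕ} (hn : 4 ≤ n) (G : SimpleGraph (Fin n)) [DecidableRel G.Adj]
    (v a b : Fin n) (h1 : v ≠ a) (h2 : v ≠ b) (h3 : a ≠ b)
    (hv : G.degree v = n - 1) (ha : G.degree a = 2)
    (hall : ∀ u, 2 ≤ G.degree u → u = v ∨ u = a ∨ u = b) :
    Nonempty (G ≃g unicyclicStar n) := by
  have hvadj : ∀ u, u ≠ v → G.Adj v u := by
    have : G.neighborFinset v = Finset.univ.erase v := by
      apply Finset.eq_of_subset_of_card_le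
      · intro w hw
        simp only [mem_neighborFinset] at hw
        simp [hw.ne']
      · rw [card_neighborFinset_eq_degree, hv, Finset.card_erase_of_mem (Finset.mem_univ _)]
        simp
    intro u hu
    have h : u ∈ G.neighborFinset v := by rw [this]; simp [hu]
    simpa using h
  have hab : G.Adj a b := by
    have : ∃ w ∈ G.neighborFinset a, w ≠ v := by
      apply Finset.exists_mem_ne
      rw [card_neighborFinset_eq_degree, ha]; norm_num
    obtain ⟨w, hw, hwv⟩ := this
    simp only [mem_neighborFinset] at hw
    have hd := two_le_degree G (hvadj w hwv).symm hw.symm h1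
    rcases hall w hd with h | h | h
    · exact absurd h hwv
    · exact absurd h hw.ne'
    · exact h ▸ hw
  have key : ∀ x y, x ≠ v → y ≠ v → G.Adj x y → x = a ∨ x = b := by
    intro x y hx hy h
    have := hall x (two_le_degree G (hvadj x hx).symm h hy.symm)
    tauto
  obtain ⟨e, e1, e2, e3⟩ := exists_perm v a b ⟨0, by omega⟩ ⟨1, by omega⟩ ⟨2, by omega⟩ h1 h2 h3
    (by simp) (by simp) (by simp)
  refine ⟨⟨e, ?_⟩⟩
  have q0 : ∀ x, (e x).val = 0 ↔ x = v := fun x => by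
    rw [← e.injective.eq_iff, e1, Fin.ext_iff]
  have q1 : ∀ x, (e x).val = 1 ↔ x = a := fun x => by
    rw [← e.injective.eq_iff, e2, Fin.ext_iff]
  have q2 : ∀ x, (e x).val = 2 ↔ x = b := fun x => by
    rw [← e.injective.eq_iff, e3, Fin.ext_iff]
  intro x y
  simp only [unicyclicStar, SimpleGraph.fromRel_adj, q0, q1, q2, ne_eq, e.injective.eq_iff]
  constructor
  · rintro ⟨hne, (rfl | ⟨rfl, rfl⟩) | (rfl | ⟨rfl, rfl⟩)⟩
    · exact hvadj _ (Ne.symm hne)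
    · exact hab
    · exact (hvadj _ hne).symm
    · exact hab.symm
  · intro h
    refine ⟨h.ne, ?_⟩
    by_cases hx : x = v
    · exact Or.inl (Or.inl hx)
    by_cases hy : y = v
    · exact Or.inr (Or.inl hy)
    have kx := key x y hx hy h
    have ky := key y x hy hx h.symm
    have := h.ne
    grind

lemma unicyclicStar_invdeg {n : ℕ} (hn : 4 ≤ n) (G : SimpleGraph (Fin n)) [DecidableRel G.Adj]
    (e : G ≃g unicyclicStar n) :
    ∑ u : Fin n, (1 : ℝ) / (G.degree u) = 1 / ((n : ℝ) - 1) + (n : ℝ) - 2 := by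
  classical
  have h0 : ∑ u : Fin n, (1 : ℝ) / (G.degree u)
      = ∑ u : Fin n, (1 : ℝ) / ((unicyclicStar n).degree u) := by
    refine Fintype.sum_equiv e.toEquiv _ _ (fun x => ?_)
    have : (unicyclicStar n).degree (e.toEquiv x) = G.degree x := e.degree_eq x
    rw [this]
  rw [h0]
  obtain ⟨m, rfl⟩ : ∃ m, n = m + 3 := ⟨n - 3, by omega⟩
  have hadj : ∀ x y : Fin (m+3), y ∈ (unicyclicStar (m+3)).neighborFinset x ↔
      x.val ≠ y.val ∧ ((x.val = 0 ∨ (x.val = 1 ∧ y.val = 2)) ∨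
        (y.val = 0 ∨ (y.val = 1 ∧ x.val = 2))) := by
    intro x y
    rw [mem_neighborFinset, unicyclicStar, SimpleGraph.fromRel_adj, ne_eq, Fin.ext_iff]
  have d0 : ∀ x : Fin (m+3), x.val = 0 → (unicyclicStar (m+3)).degree x = m + 2 := by
    intro x hx
    rw [← card_neighborFinset_eq_degree]
    have : (unicyclicStar (m+3)).neighborFinset x = Finset.univ.erase x := by
      ext y
      rw [hadj, Finset.mem_erase]
      simp only [Finset.mem_univ, and_true, ne_eq, Fin.ext_iff]
      omega
    rw [this, Finset.card_erase_of_mem (Finset.mem_univ _)]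
    simp
  have d1 : ∀ x : Fin (m+3), x.val = 1 → (unicyclicStar (m+3)).degree x = 2 := by
    intro x hx
    rw [← card_neighborFinset_eq_degree]
    have : (unicyclicStar (m+3)).neighborFinset x = {⟨0, by omega⟩, ⟨2, by omega⟩} := by
      ext y
      rw [hadj, Finset.mem_insert, Finset.mem_singleton, Fin.ext_iff, Fin.ext_iff]
      dsimp only
      omega
    rw [this, Finset.card_pair (by simp)]
  have d2 : ∀ x : Fin (m+3), x.val = 2 → (unicyclicStar (m+3)).degree x = 2 := by
    intro x hx
    rw [← card_neighborFinset_eq_degree]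
    have : (unicyclicStar (m+3)).neighborFinset x = {⟨0, by omega⟩, ⟨1, by omega⟩} := by
      ext y
      rw [hadj, Finset.mem_insert, Finset.mem_singleton, Fin.ext_iff, Fin.ext_iff]
      dsimp only
      omega
    rw [this, Finset.card_pair (by simp)]
  have d3 : ∀ i : Fin m, (unicyclicStar (m+3)).degree i.succ.succ.succ = 1 := by
    intro i
    rw [← card_neighborFinset_eq_degree]
    have : (unicyclicStar (m+3)).neighborFinset i.succ.succ.succ = {⟨0, by omega⟩} := by
      ext y
      rw [hadj, Finset.mem_singleton, Fin.ext_iff]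
      simp only [Fin.val_succ]
      omega
    rw [this, Finset.card_singleton]
  rw [Fin.sum_univ_succ, Fin.sum_univ_succ, Fin.sum_univ_succ, d0 0 rfl, d1 _ rfl, d2 _ rfl,
    Finset.sum_congr rfl (fun i _ => by rw [d3 i])]
  push_cast
  simp
  ring

lemma div_bound (d : ℕ) (hd : 1 ≤ d) :
    (0:ℝ) ≤ 1 / (d:ℝ) - (1 - (d:ℝ)/4) := by
  have : (0:ℝ) < d := by exact_mod_cast hd
  have h : 1 / (d:ℝ) - (1 - (d:ℝ)/4) = ((d:ℝ) - 2)^2 / (4 * d) := by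
    field_simp; ring
  rw [h]; positivity

lemma div_bound_eq (d : ℕ) (hd : 1 ≤ d) (h0 : 1 / (d:ℝ) - (1 - (d:ℝ)/4) = 0) : d = 2 := by
  have : (0:ℝ) < d := by exact_mod_cast hd
  have h : 1 / (d:ℝ) - (1 - (d:ℝ)/4) = ((d:ℝ) - 2)^2 / (4 * d) := by
    field_simp; ring
  rw [h, div_eq_zero_iff] at h0
  rcases h0 with h0 | h0
  · have : (d:ℝ) = 2 := by nlinarith
    exact_mod_cast this
  · linarith

/-- slack in the chord bound -/
lemma chord (n d : ℕ) (hn : 4 ≤ n) (hd : 1 ≤ d) :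
    (1 / 2 - ((d:ℝ) - 2) / (2 * ((n:ℝ) - 1))) - 1 / (d:ℝ)
      = ((d:ℝ) - 2) * ((n:ℝ) - 1 - d) / (2 * d * ((n:ℝ) - 1)) := by
  have h1 : (0:ℝ) < d := by exact_mod_cast hd
  have h2 : (4:ℝ) ≤ n := by exact_mod_cast hn
  have h3 : (n:ℝ) - 1 ≠ 0 := by linarith
  field_simp
  ring

theorem stmt9 {n : ℕ} (hn : 4 ≤ n) (G : SimpleGraph (Fin n)) [DecidableRel G.Adj]
    (hG : IsUnicyclic G) :
    ((n : ℝ) / 2 ≤ ∑ u : Fin n, (1 : ℝ) / (G.degree u)) ∧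
    (∑ u : Fin n, (1 : ℝ) / (G.degree u) ≤ 1 / ((n : ℝ) - 1) + (n : ℝ) - 2) ∧
    ((∑ u : Fin n, (1 : ℝ) / (G.degree u) = (n : ℝ) / 2) ↔
      Nonempty (G ≃g SimpleGraph.cycleGraph n)) ∧
    ((∑ u : Fin n, (1 : ℝ) / (G.degree u) = 1 / ((n : ℝ) - 1) + (n : ℝ) - 2) ↔
      Nonempty (G ≃g unicyclicStar n)) := by
  have hnR : (4:ℝ) ≤ n := by exact_mod_cast hn
  have hN : (0:ℝ) < (n:ℝ) - 1 := by linarith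
  have : Nontrivial (Fin n) := Fin.nontrivial_iff_two_le.mpr (by omega)
  have hdpos : ∀ u, 1 ≤ G.degree u := fun u => hG.1.preconnected.degree_pos_of_nontrivial u
  have hdlt : ∀ u, G.degree u ≤ n - 1 := fun u => by
    have := G.degree_lt_card_verts u
    simp only [Fintype.card_fin] at this
    omega
  have hsumN : ∑ u, G.degree u = 2 * n := by
    rw [G.sum_degrees_eq_twice_card_edges, hG.2]
  have hsum : ∑ u, (G.degree u : ℝ) = 2 * n := by exact_mod_cast hsumN
  have hk := three_le_nonleaf G hG
  -- lower bound slack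
  have hlow : ∑ u : Fin n, (1 / (G.degree u : ℝ) - (1 - (G.degree u : ℝ)/4))
      = ∑ u : Fin n, (1 : ℝ) / (G.degree u) - n / 2 := by
    rw [Finset.sum_sub_distrib, Finset.sum_sub_distrib, ← Finset.sum_div, hsum]
    simp
    ring
  have hlow0 : ∀ u ∈ (Finset.univ : Finset (Fin n)),
      0 ≤ (1 / (G.degree u : ℝ) - (1 - (G.degree u : ℝ)/4)) :=
    fun u _ => div_bound _ (hdpos u)
  -- upper bound slack
  set c : ℝ := 1 / 2 - 1 / (2 * ((n:ℝ) - 1)) with hc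
  have hcpos : 0 < c := by
    rw [hc, sub_pos]
    apply one_div_lt_one_div_of_lt <;> linarith
  let K := Finset.univ.filter (fun u => 2 ≤ G.degree u)
  let s : Fin n → ℝ := fun u =>
    (1 / 2 - ((G.degree u:ℝ) - 2) / (2 * ((n:ℝ) - 1))) + (if 2 ≤ G.degree u then 0 else c)
      - 1 / (G.degree u : ℝ)
  have hs2 : ∀ u, 2 ≤ G.degree u → s u = ((G.degree u:ℝ) - 2) * ((n:ℝ) - 1 - G.degree u)
      / (2 * G.degree u * ((n:ℝ) - 1)) := by
    intro u hu
    simp only [s, if_pos hu]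
    rw [← chord n _ hn (hdpos u)]
    ring
  have hs1 : ∀ u, ¬ 2 ≤ G.degree u → s u = 0 := by
    intro u hu
    have h1 : G.degree u = 1 := by have := hdpos u; omega
    simp only [s, if_neg hu, h1, hc]
    push_cast
    field_simp
    ring
  have hs0 : ∀ u ∈ (Finset.univ : Finset (Fin n)), 0 ≤ s u := by
    intro u _
    by_cases hu : 2 ≤ G.degree u
    · rw [hs2 u hu]
      have a1 : (2:ℝ) ≤ G.degree u := by exact_mod_cast hu
      have a2 : (G.degree u : ℝ) ≤ (n:ℝ) - 1 := by
        have : G.degree u + 1 ≤ n := by have := hdlt u; omega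
        have : (G.degree u : ℝ) + 1 ≤ n := by exact_mod_cast this
        linarith
      apply div_nonneg
      · apply mul_nonneg <;> linarith
      · positivity
    · rw [hs1 u hu]
  have hsS : ∑ u, s u + c * ((K.card : ℝ) - 3)
      = 1 / ((n : ℝ) - 1) + (n : ℝ) - 2 - ∑ u : Fin n, (1 : ℝ) / (G.degree u) := by
    have hi : ∑ u : Fin n, (if 2 ≤ G.degree u then (0:ℝ) else c) = c * (n - K.card) := by
      have : ∀ u : Fin n, (if 2 ≤ G.degree u then (0:ℝ) else c)
          = c - (if 2 ≤ G.degree u then c else 0) := by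
        intro u; split_ifs <;> simp
      rw [Finset.sum_congr rfl (fun u _ => this u), Finset.sum_sub_distrib, ← Finset.sum_filter]
      simp [K]
      ring
    simp only [s]
    rw [Finset.sum_sub_distrib, Finset.sum_add_distrib, Finset.sum_sub_distrib, 
      ← Finset.sum_div Finset.univ (fun u => (G.degree u : ℝ) - 2),
      Finset.sum_sub_distrib, hsum, hi]
    simp only [Finset.sum_const, Finset.card_univ, Fintype.card_fin, nsmul_eq_mul, hc]
    field_simp
    ring
  have hK3 : (0:ℝ) ≤ (K.card : ℝ) - 3 := by
    have : (3:ℝ) ≤ K.card := by exact_mod_cast hk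
    linarith
  have hSnn := Finset.sum_nonneg hs0
  have hcK := mul_nonneg hcpos.le hK3
  refine ⟨?_, ?_, ⟨?_, ?_⟩, ⟨?_, ?_⟩⟩
  · have := Finset.sum_nonneg hlow0
    linarith
  · linarith
  · intro h
    rw [h, sub_self, Finset.sum_eq_zero_iff_of_nonneg hlow0] at hlow
    exact iso_cycle G hG (fun u => div_bound_eq _ (hdpos u) (hlow u (Finset.mem_univ u)))
  · rintro ⟨e⟩
    have : ∀ u, G.degree u = 2 := fun u => by
      rw [← e.degree_eq u]; exact cycleGraph_degree' (by omega) _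
    simp [this]
    ring
  · intro h
    rw [h, sub_self] at hsS
    have hS : ∑ u, s u = 0 := by linarith
    have hKz : c * ((K.card : ℝ) - 3) = 0 := by linarith
    have hK : K.card = 3 := by
      rcases mul_eq_zero.mp hKz with h | h
      · linarith
      · have : (K.card : ℝ) = 3 := by linarith
        exact_mod_cast this
    rw [Finset.sum_eq_zero_iff_of_nonneg hs0] at hS
    have hdeg : ∀ u, 2 ≤ G.degree u → G.degree u = 2 ∨ G.degree u = n - 1 := by
      intro u hu
      have h1 := hS u (Finset.mem_univ u)
      have hp : (0:ℝ) < G.degree u := by exact_mod_cast hdpos u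
      rw [hs2 u hu, div_eq_zero_iff, mul_eq_zero] at h1
      rcases h1 with (h1 | h1) | h1
      · left
        have : (G.degree u : ℝ) = 2 := by linarith
        exact_mod_cast this
      · right
        have : (G.degree u : ℝ) + 1 = n := by linarith
        have : G.degree u + 1 = n := by exact_mod_cast this
        omega
      · exfalso
        have : 0 < 2 * (G.degree u : ℝ) * ((n:ℝ) - 1) := by positivity
        linarith
    obtain ⟨x, y, z, hxy, hxz, hyz, hKe⟩ := Finset.card_eq_three.mp hK
    have hmem : ∀ u, 2 ≤ G.degree u ↔ u = x ∨ u = y ∨ u = z := by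
      intro u
      have : u ∈ K ↔ u ∈ ({x, y, z} : Finset (Fin n)) := by rw [hKe]
      simpa [K] using this
    have hsplit : G.degree x + G.degree y + G.degree z = n + 3 := by
      have e1 : ∑ u, G.degree u = ∑ u ∈ K, G.degree u
          + ∑ u ∈ Finset.univ.filter (fun u => ¬ 2 ≤ G.degree u), G.degree u :=
        (Finset.sum_filter_add_sum_filter_not _ _ _).symm
      have e2 : ∑ u ∈ Finset.univ.filter (fun u => ¬ 2 ≤ G.degree u), G.degree u
          = (Finset.univ.filter (fun u => ¬ 2 ≤ G.degree u)).card := by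
        rw [Finset.card_eq_sum_ones]
        apply Finset.sum_congr rfl
        intro u hu
        simp only [Finset.mem_filter, Finset.mem_univ, true_and] at hu
        have := hdpos u
        omega
      have e3 : K.card + (Finset.univ.filter (fun u => ¬ 2 ≤ G.degree u)).card = n := by
        have := Finset.card_filter_add_card_filter_not (s := (Finset.univ : Finset (Fin n)))
          (fun u => 2 ≤ G.degree u)
        simpa [K] using this
      have e4 : ∑ u ∈ K, G.degree u = G.degree x + (G.degree y + G.degree z) := by
        rw [hKe, Finset.sum_insert (by simp [hxy, hxz]), Finset.sum_pair hyz]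
      omega
    have dx := hdeg x ((hmem x).2 (by simp))
    have dy := hdeg y ((hmem y).2 (by simp))
    have dz := hdeg z ((hmem z).2 (by simp))
    have hcases : (G.degree x = n - 1 ∧ G.degree y = 2 ∧ G.degree z = 2) ∨
        (G.degree y = n - 1 ∧ G.degree x = 2 ∧ G.degree z = 2) ∨
        (G.degree z = n - 1 ∧ G.degree x = 2 ∧ G.degree y = 2) := by omega
    rcases hcases with ⟨p, q, r⟩ | ⟨p, q, r⟩ | ⟨p, q, r⟩
    · exact iso_star hn G x y z hxy hxz hyz p q (fun u hu => (hmem u).1 hu)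
    · exact iso_star hn G y x z hxy.symm hyz hxz p q (fun u hu => by have := (hmem u).1 hu; tauto)
    · exact iso_star hn G z x y hxz.symm hyz.symm hxy p q
        (fun u hu => by have := (hmem u).1 hu; tauto)
  · rintro ⟨e⟩
    exact unicyclicStar_invdeg hn G e
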